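/- Let G1 and G2 be disjoint connected simple graphs with u ∈ V(G1), v ∈ V(G2), |V(Gi)| ≥ 2 and mi = |E(Gi)| ≥ 1, and suppose m2 ≥ m1. For s ≥ 4 let P_s = p1p2⋯p_s be a path on s vertices disjoint from G1 and G2, let H = P_s + p_{s−2}p_s, and let H' = H − p_{s−2}p_s − p_{s−1}p_s + p1p_s + p2p_s. Let G be obtained from G1, G2 and H by identifying u with p1 and v with p_{s−1}, and let G' be obtained from G1, G2 and H' by identifying u with p1 and v with p_{s−1}. Then W_e(G') − W_e(G) = (m2 − m1)(2s − 6); in particular W_e(G) ≤ W_e(G'), with equality if and only if m1 = m2. -/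

import Mathlib

open SimpleGraph Finset
open scoped Classical

/-- The distance `d_G(f,g)` between two edges: `0` if they coincide, otherwise the minimum
distance between endpoints plus one (i.e. the distance in the line graph). -/
noncomputable def eDist {V : Type*} (G : SimpleGraph V) (e f : Sym2 V) : ℕ :=
  if e = f then 0 else sInf {n : ℕ | ∃ u ∈ e, ∃ w ∈ f, G.dist u w = n} + 1

/-- The distance `d_G(v,f)` between a vertex and an edge: the minimum distance to an endpoint. -/
noncomputable def vDist {V : Type*} (G : SimpleGraph V) (v : V) (e : Sym2 V) : ℕ :=
  sInf {n : ℕ | ∃ u ∈ e, G.dist v u = n}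

/-- The edge-Wiener index `W_e(G)`: the sum of `eDist` over unordered pairs of edges. -/
noncomputable def edgeWiener {V : Type*} [Fintype V] (G : SimpleGraph V) : ℕ :=
  (∑ e ∈ G.edgeFinset, ∑ f ∈ G.edgeFinset, eDist G e f) / 2

/-- The vertex of `V1 ⊕ {y : V2 // y ≠ u2}` corresponding to `x : V2` after identifying
`u2` with `u1`. -/
noncomputable def glueVert {V1 V2 : Type*} (u1 : V1) (u2 : V2) (x : V2) :
    V1 ⊕ {y : V2 // y ≠ u2} :=
  if h : x = u2 then Sum.inl u1 else Sum.inr ⟨x, h⟩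

/-- The graph obtained from disjoint graphs `G1`, `G2` by identifying `u1 ∈ V(G1)` with
`u2 ∈ V(G2)` into a single vertex (namely `Sum.inl u1`). -/
noncomputable def joinAt {V1 V2 : Type*} (G1 : SimpleGraph V1) (G2 : SimpleGraph V2)
    (u1 : V1) (u2 : V2) : SimpleGraph (V1 ⊕ {y : V2 // y ≠ u2}) :=
  SimpleGraph.fromRel (fun a b =>
    (∃ x y, G1.Adj x y ∧ a = Sum.inl x ∧ b = Sum.inl y) ∨
    (∃ x y, G2.Adj x y ∧ a = glueVert u1 u2 x ∧ b = glueVert u1 u2 y))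

theorem vDist_mk {V : Type*} (G : SimpleGraph V) (v x y : V) :
    vDist G v s(x, y) = min (G.dist v x) (G.dist v y) := by
  unfold vDist
  apply le_antisymm
  · apply le_min
    · exact Nat.sInf_le ⟨x, by simp, rfl⟩
    · exact Nat.sInf_le ⟨y, by simp, rfl⟩
  · apply le_csInf
    · exact ⟨_, x, by simp, rfl⟩
    · rintro n ⟨w, hw, rfl⟩
      rcases Sym2.mem_iff.1 hw with rfl | rfl
      · exact min_le_left _ _
      · exact min_le_right _ _

theorem eDist_mk {V : Type*} (G : SimpleGraph V) (a b x y : V) (h : s(a, b) ≠ s(x, y)) :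
    eDist G s(a, b) s(x, y) =
      min (min (G.dist a x) (G.dist a y)) (min (G.dist b x) (G.dist b y)) + 1 := by
  unfold eDist
  rw [if_neg h]
  congr 1
  apply le_antisymm
  · refine le_min (le_min ?_ ?_) (le_min ?_ ?_)
    · exact Nat.sInf_le ⟨a, by simp, x, by simp, rfl⟩
    · exact Nat.sInf_le ⟨a, by simp, y, by simp, rfl⟩
    · exact Nat.sInf_le ⟨b, by simp, x, by simp, rfl⟩
    · exact Nat.sInf_le ⟨b, by simp, y, by simp, rfl⟩
  · apply le_csInf
    · exact ⟨_, a, by simp, x, by simp, rfl⟩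
    · rintro n ⟨w, hw, z, hz, rfl⟩
      rcases Sym2.mem_iff.1 hw with rfl | rfl <;> rcases Sym2.mem_iff.1 hz with rfl | rfl <;>
        simp

theorem eDist_comm' {V : Type*} (G : SimpleGraph V) (e f : Sym2 V) :
    eDist G e f = eDist G f e := by
  by_cases h : e = f
  · rw [h]
  · induction e with | _ a b
    induction f with | _ x y
    rw [eDist_mk G _ _ _ _ h, eDist_mk G _ _ _ _ (Ne.symm h)]
    rw [G.dist_comm (u := x) (v := a), G.dist_comm (u := x) (v := b),
      G.dist_comm (u := y) (v := a), G.dist_comm (u := y) (v := b)]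
    omega

/-- Dist-preserving injections preserve `eDist`. -/
theorem eDist_map {V W : Type*} (G : SimpleGraph V) (K : SimpleGraph W) (φ : V → W)
    (hφ : Function.Injective φ) (hd : ∀ x y, K.dist (φ x) (φ y) = G.dist x y) (e f : Sym2 V) :
    eDist K (e.map φ) (f.map φ) = eDist G e f := by
  by_cases h : e = f
  · simp [h, eDist]
  · have h' : e.map φ ≠ f.map φ := fun h2 => h (Sym2.map.injective hφ h2)
    induction e with | _ a b
    induction f with | _ x y
    rw [Sym2.map_mk, Sym2.map_mk] at h' ⊢
    rw [eDist_mk G _ _ _ _ h, eDist_mk K _ _ _ _ h']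
    simp [hd]

theorem vDist_map {V W : Type*} (G : SimpleGraph V) (K : SimpleGraph W) (φ : V → W)
    (v : V) (w : W) (k : ℕ)
    (hd : ∀ y, K.dist w (φ y) = k + G.dist v y) (e : Sym2 V) :
    vDist K w (e.map φ) = k + vDist G v e := by
  induction e with | _ a b
  rw [Sym2.map_mk, vDist_mk, vDist_mk, hd, hd]
  omega

/-- Lower bound on distance by 1-Lipschitz functions. -/
theorem le_dist_of_lip {V : Type*} (G : SimpleGraph V) (hG : G.Connected) (f : V → ℕ)
    (hf : ∀ x y, G.Adj x y → f y ≤ f x + 1) (p q : V) : f q ≤ f p + G.dist p q := by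
  obtain ⟨w, hw⟩ := hG.exists_walk_length_eq_dist p q
  rw [← hw]
  clear hw
  induction w with
  | nil => simp
  | cons h w ih =>
    have := hf _ _ h
    rw [Walk.length_cons]
    omega

theorem dist_hom_le {V W : Type*} (G : SimpleGraph V) (K : SimpleGraph W) (hG : G.Connected)
    (φ : V → W) (h : ∀ x y, G.Adj x y → K.Adj (φ x) (φ y)) (x y : V) :
    K.dist (φ x) (φ y) ≤ G.dist x y := by
  obtain ⟨w, hw⟩ := hG.exists_walk_length_eq_dist x y
  let F : G →g K := ⟨φ, fun {a b} hab => h a b hab⟩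
  rw [← hw, ← Walk.length_map F w]
  exact dist_le _

theorem reach_hom {V W : Type*} (G : SimpleGraph V) (K : SimpleGraph W) (hG : G.Connected)
    (φ : V → W) (h : ∀ x y, G.Adj x y → K.Adj (φ x) (φ y)) (x y : V) :
    K.Reachable (φ x) (φ y) := by
  let F : G →g K := ⟨φ, fun {a b} hab => h a b hab⟩
  exact (hG.preconnected x y).map F

theorem adj_lip {V : Type*} (G : SimpleGraph V) (hG : G.Connected) (c x y : V) (h : G.Adj x y) :
    G.dist c y ≤ G.dist c x + 1 := by
  have := hG.dist_triangle (u := c) (v := x) (w := y)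
  rw [dist_eq_one_iff_adj.2 h] at this
  exact this

section join
variable {V1 V2 : Type*} (A : SimpleGraph V1) (B : SimpleGraph V2) (a : V1) (b : V2)

theorem glue_self : glueVert a b b = Sum.inl a := by simp [glueVert]

theorem glue_ne (y : {y : V2 // y ≠ b}) : glueVert a b y.1 = Sum.inr y := by
  simp [glueVert, y.2]

theorem glue_inj : Function.Injective (glueVert a b) := by
  intro x y h
  unfold glueVert at h
  split_ifs at h <;> simp_all

theorem glue_eq_inl {x : V2} {y : V1} (h : glueVert a b x = Sum.inl y) : x = b := by
  unfold glueVert at h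
  split_ifs at h <;> simp_all

theorem joinAt_adj (p q) : (joinAt A B a b).Adj p q ↔
    (∃ x y, A.Adj x y ∧ p = Sum.inl x ∧ q = Sum.inl y) ∨
    (∃ x y, B.Adj x y ∧ p = glueVert a b x ∧ q = glueVert a b y) := by
  unfold joinAt
  rw [SimpleGraph.fromRel_adj]
  constructor
  · rintro ⟨-, h | h⟩
    · exact h
    · rcases h with ⟨x, y, h, rfl, rfl⟩ | ⟨x, y, h, rfl, rfl⟩
      · exact Or.inl ⟨y, x, h.symm, rfl, rfl⟩
      · exact Or.inr ⟨y, x, h.symm, rfl, rfl⟩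
  · intro h
    refine ⟨?_, Or.inl h⟩
    rcases h with ⟨x, y, h, rfl, rfl⟩ | ⟨x, y, h, rfl, rfl⟩
    · exact fun h' => h.ne (Sum.inl_injective h')
    · exact fun h' => h.ne (glue_inj a b h')

theorem joinAt_adj_inl (x y) (h : A.Adj x y) : (joinAt A B a b).Adj (Sum.inl x) (Sum.inl y) :=
  (joinAt_adj A B a b _ _).2 (Or.inl ⟨x, y, h, rfl, rfl⟩)

theorem joinAt_adj_glue (x y) (h : B.Adj x y) :
    (joinAt A B a b).Adj (glueVert a b x) (glueVert a b y) :=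
  (joinAt_adj A B a b _ _).2 (Or.inr ⟨x, y, h, rfl, rfl⟩)


theorem joinAt_conn (hA : A.Connected) (hB : B.Connected) : (joinAt A B a b).Connected := by
  have key : ∀ p, (joinAt A B a b).Reachable p (Sum.inl a) := by
    rintro (x | y)
    · exact reach_hom A _ hA Sum.inl (joinAt_adj_inl A B a b) x a
    · rw [← glue_ne, ← glue_self a b]
      exact reach_hom B _ hB _ (joinAt_adj_glue A B a b) _ _
  have : Nonempty (V1 ⊕ {y : V2 // y ≠ b}) := ⟨Sum.inl a⟩
  exact ⟨fun p q => (key p).trans (key q).symm⟩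

theorem joinAt_dist_inl_glue (hA : A.Connected) (hB : B.Connected) (c : V1) (y : V2) :
    (joinAt A B a b).dist (Sum.inl c) (glueVert a b y) = A.dist c a + B.dist b y := by
  have hJ := joinAt_conn A B a b hA hB
  apply le_antisymm
  · refine (hJ.dist_triangle (v := Sum.inl a)).trans ?_
    have h1 := dist_hom_le A _ hA Sum.inl (joinAt_adj_inl A B a b) c a
    have h2 := dist_hom_le B _ hB _ (joinAt_adj_glue A B a b) b y
    rw [glue_self] at h2
    omega
  · let f : V1 ⊕ {y : V2 // y ≠ b} → ℕ :=
      Sum.elim (fun x => A.dist c x) (fun y => A.dist c a + B.dist b y.1)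
    have hf : ∀ y, f (glueVert a b y) = A.dist c a + B.dist b y := by
      intro y
      by_cases h : y = b
      · subst h; simp [glue_self, f]
      · rw [glue_ne a b ⟨y, h⟩]; simp [f]
    have := le_dist_of_lip _ hJ f ?_ (Sum.inl c) (glueVert a b y)
    · rw [hf] at this
      simpa [f] using this
    · intro p q h
      rcases (joinAt_adj A B a b _ _).1 h with ⟨x, y, h', rfl, rfl⟩ | ⟨x, y, h', rfl, rfl⟩
      · exact adj_lip A hA c x y h'
      · rw [hf, hf]
        have := adj_lip B hB b x y h'
        omega

theorem joinAt_dist_inl (hA : A.Connected) (hB : B.Connected) (c x : V1) :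
    (joinAt A B a b).dist (Sum.inl c) (Sum.inl x) = A.dist c x := by
  have hJ := joinAt_conn A B a b hA hB
  apply le_antisymm
  · exact dist_hom_le A _ hA Sum.inl (joinAt_adj_inl A B a b) c x
  · let f : V1 ⊕ {y : V2 // y ≠ b} → ℕ :=
      Sum.elim (fun x => A.dist c x) (fun y => A.dist c a)
    have hf : ∀ y, f (glueVert a b y) = A.dist c a := by
      intro y
      by_cases h : y = b
      · subst h; simp [glue_self, f]
      · rw [glue_ne a b ⟨y, h⟩]; simp [f]
    have := le_dist_of_lip _ hJ f ?_ (Sum.inl c) (Sum.inl x)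
    · simpa [f] using this
    · intro p q h
      rcases (joinAt_adj A B a b _ _).1 h with ⟨x, y, h', rfl, rfl⟩ | ⟨x, y, h', rfl, rfl⟩
      · exact adj_lip A hA c x y h'
      · rw [hf, hf]
        omega

theorem joinAt_dist_glue (hA : A.Connected) (hB : B.Connected) (c x : V2) :
    (joinAt A B a b).dist (glueVert a b c) (glueVert a b x) = B.dist c x := by
  have hJ := joinAt_conn A B a b hA hB
  apply le_antisymm
  · exact dist_hom_le B _ hB _ (joinAt_adj_glue A B a b) c x
  · let f : V1 ⊕ {y : V2 // y ≠ b} → ℕ :=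
      Sum.elim (fun x => B.dist c b) (fun y => B.dist c y.1)
    have hf : ∀ y, f (glueVert a b y) = B.dist c y := by
      intro y
      by_cases h : y = b
      · subst h; simp [glue_self, f]
      · rw [glue_ne a b ⟨y, h⟩]; simp [f]
    have := le_dist_of_lip _ hJ f ?_ (glueVert a b c) (glueVert a b x)
    · rw [hf, hf] at this
      simpa using this
    · intro p q h
      rcases (joinAt_adj A B a b _ _).1 h with ⟨x, y, h', rfl, rfl⟩ | ⟨x, y, h', rfl, rfl⟩
      · simp [f]
      · rw [hf, hf]
        exact adj_lip B hB c x y h'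

theorem map_ne {e : Sym2 V1} {f : Sym2 V2} (hf : f ∈ B.edgeSet) :
    e.map Sum.inl ≠ f.map (glueVert a b) := by
  induction e with | _ x y
  induction f with | _ z w
  intro h
  rw [Sym2.map_mk, Sym2.map_mk, Sym2.eq_iff] at h
  have hzw : z ≠ w := B.ne_of_adj hf
  rcases h with ⟨h1, h2⟩ | ⟨h1, h2⟩
  · exact hzw ((glue_eq_inl a b h1.symm).trans (glue_eq_inl a b h2.symm).symm)
  · exact hzw ((glue_eq_inl a b h2.symm).trans (glue_eq_inl a b h1.symm).symm)

theorem joinAt_eDist_cross (hA : A.Connected) (hB : B.Connected) (e : Sym2 V1) (f : Sym2 V2) (hf : f ∈ B.edgeSet) :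
    eDist (joinAt A B a b) (e.map Sum.inl) (f.map (glueVert a b)) =
      vDist A a e + vDist B b f + 1 := by
  have hne := map_ne B a b (e := e) hf
  induction e with | _ x y
  induction f with | _ z w
  rw [Sym2.map_mk, Sym2.map_mk] at hne ⊢
  rw [eDist_mk _ _ _ _ _ hne, vDist_mk, vDist_mk]
  simp only [joinAt_dist_inl_glue A B a b hA hB]
  rw [A.dist_comm (u := a) (v := x), A.dist_comm (u := a) (v := y)]
  omega
end join

/-- Double edge sum. -/
noncomputable def SS {V : Type*} [Fintype V] (G : SimpleGraph V) : ℕ :=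
  ∑ e ∈ G.edgeFinset, ∑ f ∈ G.edgeFinset, eDist G e f

/-- Vertex-edge distance sum. -/
noncomputable def DD {V : Type*} [Fintype V] (G : SimpleGraph V) (v : V) : ℕ :=
  ∑ e ∈ G.edgeFinset, vDist G v e

/-- Number of edges. -/
noncomputable def MM {V : Type*} [Fintype V] (G : SimpleGraph V) : ℕ := G.edgeFinset.card

section join2
variable {V1 V2 : Type*} [Fintype V1] [Fintype V2]
  (A : SimpleGraph V1) (B : SimpleGraph V2) (a : V1) (b : V2)

theorem join_edges : (joinAt A B a b).edgeFinset =
    A.edgeFinset.image (Sym2.map Sum.inl) ∪ B.edgeFinset.image (Sym2.map (glueVert a b)) := by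
  ext e
  simp only [mem_edgeFinset, Finset.mem_union, Finset.mem_image]
  constructor
  · intro h
    induction e with | _ p q
    rcases (joinAt_adj A B a b _ _).1 h with ⟨x, y, h', rfl, rfl⟩ | ⟨x, y, h', rfl, rfl⟩
    · exact Or.inl ⟨s(x, y), h', rfl⟩
    · exact Or.inr ⟨s(x, y), h', rfl⟩
  · rintro (⟨e, h, rfl⟩ | ⟨e, h, rfl⟩)
    · induction e with | _ x y
      exact joinAt_adj_inl A B a b x y h
    · induction e with | _ x y
      exact joinAt_adj_glue A B a b x y h

theorem join_sum (F : Sym2 (V1 ⊕ {y : V2 // y ≠ b}) → ℕ) :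
    ∑ e ∈ (joinAt A B a b).edgeFinset, F e = ∑ e ∈ A.edgeFinset, F (e.map Sum.inl) +
      ∑ e ∈ B.edgeFinset, F (e.map (glueVert a b)) := by
  rw [join_edges, Finset.sum_union, Finset.sum_image, Finset.sum_image]
  · exact fun x _ y _ h => Sym2.map.injective (glue_inj a b) h
  · exact fun x _ y _ h => Sym2.map.injective Sum.inl_injective h
  · rw [Finset.disjoint_left]
    intro e h1 h2
    obtain ⟨x, hx, rfl⟩ := Finset.mem_image.1 h1
    obtain ⟨y, hy, h⟩ := Finset.mem_image.1 h2
    exact map_ne B a b (mem_edgeFinset.1 hy) h.symm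

theorem join_MM : MM (joinAt A B a b) = MM A + MM B := by
  unfold MM
  rw [Finset.card_eq_sum_ones, join_sum]
  simp


theorem join_DD (hA : A.Connected) (hB : B.Connected) (c : V1) : DD (joinAt A B a b) (Sum.inl c) =
    DD A c + MM B * A.dist c a + DD B b := by
  unfold DD MM
  rw [join_sum, add_assoc]
  congr 1
  · refine Finset.sum_congr rfl fun e _ => ?_
    rw [vDist_map A _ Sum.inl c (Sum.inl c) 0]
    · simp
    · simp [joinAt_dist_inl A B a b hA hB]
  · rw [← smul_eq_mul, ← Finset.sum_const, ← Finset.sum_add_distrib]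
    refine Finset.sum_congr rfl fun e _ => ?_
    exact vDist_map B _ _ b _ _ (joinAt_dist_inl_glue A B a b hA hB c) e

theorem join_SS (hA : A.Connected) (hB : B.Connected) : SS (joinAt A B a b) =
    SS A + SS B + 2 * (MM B * DD A a + MM A * DD B b + MM A * MM B) := by
  have hc : ∑ e ∈ A.edgeFinset, ∑ f ∈ B.edgeFinset,
      eDist (joinAt A B a b) (e.map Sum.inl) (f.map (glueVert a b)) =
      MM B * DD A a + MM A * DD B b + MM A * MM B := by
    have : ∀ e ∈ A.edgeFinset, ∑ f ∈ B.edgeFinset,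
      eDist (joinAt A B a b) (e.map Sum.inl) (f.map (glueVert a b)) =
        MM B * vDist A a e + DD B b + MM B := by
      intro e _
      rw [Finset.sum_congr rfl (fun f hf =>
        joinAt_eDist_cross A B a b hA hB e f (mem_edgeFinset.1 hf))]
      rw [Finset.sum_add_distrib, Finset.sum_add_distrib]
      simp [DD, MM]
    rw [Finset.sum_congr rfl this, Finset.sum_add_distrib, Finset.sum_add_distrib,
      ← Finset.mul_sum]
    simp [DD, MM]
  have hc2 : ∑ f ∈ B.edgeFinset, ∑ e ∈ A.edgeFinset,
      eDist (joinAt A B a b) (f.map (glueVert a b)) (e.map Sum.inl) =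
      MM B * DD A a + MM A * DD B b + MM A * MM B := by
    rw [← hc, Finset.sum_comm]
    simp only [eDist_comm' _ (Sym2.map (glueVert a b) _)]
  conv_lhs => unfold SS
  rw [join_sum]
  simp only [join_sum, Finset.sum_add_distrib]
  rw [hc, hc2]
  simp only [eDist_map A _ Sum.inl Sum.inl_injective (joinAt_dist_inl A B a b hA hB),
    eDist_map B _ _ (glue_inj a b) (joinAt_dist_glue A B a b hA hB)]
  unfold SS
  ring
end join2

set_option linter.unusedSectionVars false

section iso
variable {V W : Type*} [Fintype V] [Fintype W] (G : SimpleGraph V) (K : SimpleGraph W)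
  (φ : V ≃ W)

theorem iso_sum (h : ∀ x y, K.Adj (φ x) (φ y) ↔ G.Adj x y)
    (F : Sym2 W → ℕ) :
    ∑ e ∈ K.edgeFinset, F e = ∑ e ∈ G.edgeFinset, F (e.map φ) := by
  have : K.edgeFinset = G.edgeFinset.image (Sym2.map φ) := by
    ext e
    simp only [mem_edgeFinset, Finset.mem_image]
    constructor
    · intro he
      refine ⟨e.map φ.symm, ?_, ?_⟩
      · induction e with | _ x y
        rw [Sym2.map_mk, mem_edgeSet, ← h]
        simpa using he
      · induction e with | _ x y
        simp
    · rintro ⟨e, he, rfl⟩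
      induction e with | _ x y
      exact (h x y).2 he
  rw [this, Finset.sum_image]
  exact fun x _ y _ h => Sym2.map.injective φ.injective h

theorem iso_dist (h : ∀ x y, K.Adj (φ x) (φ y) ↔ G.Adj x y)
    (hG : G.Connected) (hK : K.Connected) (x y : V) :
    K.dist (φ x) (φ y) = G.dist x y := by
  apply le_antisymm
  · exact dist_hom_le G K hG φ (fun x y => (h x y).2) x y
  · have := dist_hom_le K G hK φ.symm (fun x y hxy => (h _ _).1 (by simpa using hxy)) (φ x) (φ y)
    simpa using this

theorem iso_conn (h : ∀ x y, K.Adj (φ x) (φ y) ↔ G.Adj x y)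
    (hG : G.Connected) : K.Connected := by
  have : Nonempty W := hG.nonempty.map φ
  refine ⟨fun x y => ?_⟩
  have := reach_hom G K hG φ (fun x y => (h x y).2) (φ.symm x) (φ.symm y)
  simpa using this

theorem iso_SS (h : ∀ x y, K.Adj (φ x) (φ y) ↔ G.Adj x y)
    (hG : G.Connected) : SS K = SS G := by
  have hK := iso_conn G K φ h hG
  unfold SS
  simp only [iso_sum G K φ h, eDist_map G K φ φ.injective (iso_dist G K φ h hG hK)]

theorem iso_MM (h : ∀ x y, K.Adj (φ x) (φ y) ↔ G.Adj x y)
    : MM K = MM G := by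
  unfold MM
  rw [Finset.card_eq_sum_ones, iso_sum G K φ h]
  simp

theorem iso_DD (h : ∀ x y, K.Adj (φ x) (φ y) ↔ G.Adj x y)
    (hG : G.Connected) (v : V) : DD K (φ v) = DD G v := by
  have hK := iso_conn G K φ h hG
  unfold DD
  rw [iso_sum G K φ h]
  refine Finset.sum_congr rfl fun e _ => ?_
  rw [vDist_map G K φ v (φ v) 0]
  · simp
  · simp [iso_dist G K φ h hG hK]
end iso

theorem dist_char {V : Type*} (G : SimpleGraph V) (a : V) (f : V → ℕ)
    (h0 : ∀ x, f x = 0 ↔ x = a) (hf : ∀ x y, G.Adj x y → f y ≤ f x + 1)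
    (hd : ∀ x, x ≠ a → ∃ y, G.Adj x y ∧ f y + 1 = f x) :
    G.Connected ∧ ∀ x, G.dist a x = f x := by
  have key : ∀ n x, f x = n → ∃ w : G.Walk a x, w.length = n := by
    intro n
    induction n with
    | zero =>
      intro x hx
      obtain rfl := (h0 x).1 hx
      exact ⟨Walk.nil, rfl⟩
    | succ n ih =>
      intro x hx
      have hxa : x ≠ a := fun h => by have := (h0 x).2 h; omega
      obtain ⟨y, hy, hy2⟩ := hd x hxa
      obtain ⟨w, hw⟩ := ih y (by omega)
      exact ⟨w.concat hy.symm, by simp [hw]⟩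
  have hr : ∀ x, G.Reachable a x := fun x => ⟨(key _ x rfl).choose⟩
  have hc : G.Connected := by
    have : Nonempty V := ⟨a⟩
    exact ⟨fun p q => (hr p).symm.trans (hr q)⟩
  refine ⟨hc, fun x => le_antisymm ?_ ?_⟩
  · obtain ⟨w, hw⟩ := key _ x rfl
    rw [← hw]
    exact dist_le w
  · have := le_dist_of_lip G hc f hf a x
    rw [(h0 a).2 rfl] at this
    omega

set_option linter.unusedSimpArgs false

/-- The reversal of the path `p_1 … p_{s-1}`, fixing `p_s`. -/
def flipE (s : ℕ) (hs : 2 ≤ s) : Fin s ≃ Fin s :=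
  Function.Involutive.toPerm
    (fun i => ⟨if i.1 = s - 1 then s - 1 else s - 2 - i.1, by split_ifs <;> omega⟩) (by
      intro i
      have := i.2
      apply Fin.ext
      simp only
      split_ifs <;> omega)

theorem flipE_val (s : ℕ) (hs : 2 ≤ s) (i : Fin s) :
    (flipE s hs i).1 = if i.1 = s - 1 then s - 1 else s - 2 - i.1 := rfl

theorem H_facts (s : ℕ) (hs : 4 ≤ s) (H : SimpleGraph (Fin s))
    (hadj : ∀ a b, H.Adj a b ↔ (a.1 + 1 = b.1 ∨ b.1 + 1 = a.1) ∨
      (a.1 = s - 3 ∧ b.1 = s - 1) ∨ (a.1 = s - 1 ∧ b.1 = s - 3)) :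
    H.Connected ∧ DD H ⟨0, by omega⟩ = DD H ⟨s - 2, by omega⟩ + (2 * s - 6) := by
  obtain ⟨hc, hd0⟩ := dist_char H ⟨0, by omega⟩ (fun i => if i.1 = s - 1 then s - 2 else i.1)
    (by
      intro x
      have := x.2
      simp only [Fin.ext_iff]
      split_ifs <;> omega)
    (by
      intro x y h
      rw [hadj] at h
      have := x.2
      have := y.2
      split_ifs <;> omega)
    (by
      intro x hx
      have h1 := x.2
      simp only [ne_eq, Fin.ext_iff] at hx
      by_cases h : x.1 = s - 1
      · refine ⟨⟨s - 3, by omega⟩, (hadj _ _).2 ?_, ?_⟩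
        · simp only [and_true, true_and, or_true, true_or] <;> omega
        · simp only; split_ifs <;> omega
      · refine ⟨⟨x.1 - 1, by omega⟩, (hadj _ _).2 ?_, ?_⟩
        · simp only [and_true, true_and, or_true, true_or] <;> omega
        · simp only; split_ifs <;> omega)
  obtain ⟨-, hd2⟩ := dist_char H ⟨s - 2, by omega⟩
    (fun i => if i.1 = s - 1 then 1 else s - 2 - i.1)
    (by
      intro x
      have := x.2
      rw [Fin.ext_iff]
      dsimp only
      split_ifs <;> constructor <;> intro h <;> first | omega | exact h.elim)
    (by
      intro x y h
      rw [hadj] at h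
      have := x.2
      have := y.2
      split_ifs <;> omega)
    (by
      intro x hx
      have h1 := x.2
      simp only [ne_eq, Fin.ext_iff] at hx
      by_cases h : x.1 = s - 1
      · refine ⟨⟨s - 2, by omega⟩, (hadj _ _).2 ?_, ?_⟩
        · simp only [and_true, true_and, or_true, true_or] <;> omega
        · simp only; split_ifs <;> omega
      · refine ⟨⟨x.1 + 1, by omega⟩, (hadj _ _).2 ?_, ?_⟩
        · simp only [and_true, true_and, or_true, true_or] <;> omega
        · simp only; split_ifs <;> omega)
  refine ⟨hc, ?_⟩
  let g : ℕ → Sym2 (Fin s) := fun i =>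
    if h : i + 1 < s then s(⟨i, by omega⟩, ⟨i + 1, h⟩) else s(⟨s - 3, by omega⟩, ⟨s - 1, by omega⟩)
  have hg : ∀ i (h : i + 1 < s), g i = s(⟨i, by omega⟩, ⟨i + 1, h⟩) := fun i h => dif_pos h
  have hg' : g (s - 1) = s(⟨s - 3, by omega⟩, ⟨s - 1, by omega⟩) := dif_neg (by omega)
  have hE : H.edgeFinset = (Finset.range s).image g := by
    ext e
    rw [mem_edgeFinset, Finset.mem_image]
    constructor
    · intro he
      induction e with | _ x y
      have := x.2
      have := y.2
      rcases (hadj x y).1 he with (h | h) | h | h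
      · refine ⟨x.1, by simp, ?_⟩
        rw [hg _ (by omega), Sym2.eq_iff]
        simp only [Fin.ext_iff, and_true, true_and, or_true, true_or] <;> omega
      · refine ⟨y.1, by simp, ?_⟩
        rw [hg _ (by omega), Sym2.eq_iff]
        simp only [Fin.ext_iff, and_true, true_and, or_true, true_or] <;> omega
      · refine ⟨s - 1, by simp; omega, ?_⟩
        rw [hg', Sym2.eq_iff]
        simp only [Fin.ext_iff, and_true, true_and, or_true, true_or] <;> omega
      · refine ⟨s - 1, by simp; omega, ?_⟩
        rw [hg', Sym2.eq_iff]
        simp only [Fin.ext_iff, and_true, true_and, or_true, true_or] <;> omega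
    · rintro ⟨i, hi, rfl⟩
      rw [Finset.mem_range] at hi
      by_cases h : i + 1 < s
      · rw [hg _ h, mem_edgeSet, hadj]
        simp only [and_true, true_and, or_true, true_or] <;> omega
      · obtain rfl : i = s - 1 := by omega
        rw [hg', mem_edgeSet, hadj]
        simp only [and_true, true_and, or_true, true_or] <;> omega
  have hinj : Set.InjOn g (Finset.range s) := by
    intro i hi j hj hij
    rw [Finset.mem_coe, Finset.mem_range] at hi hj
    by_cases h : i + 1 < s <;> by_cases h' : j + 1 < s
    · rw [hg _ h, hg _ h', Sym2.eq_iff] at hij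
      simp only [Fin.ext_iff] at hij
      omega
    · obtain rfl : j = s - 1 := by omega
      rw [hg _ h, hg', Sym2.eq_iff] at hij
      simp only [Fin.ext_iff] at hij
      omega
    · obtain rfl : i = s - 1 := by omega
      rw [hg _ h', hg', Sym2.eq_iff] at hij
      simp only [Fin.ext_iff] at hij
      omega
    · omega
  have hsum : ∀ F : Sym2 (Fin s) → ℕ, ∑ e ∈ H.edgeFinset, F e =
      ∑ i ∈ Finset.range (s - 2), F (g i) + F (g (s - 2)) + F (g (s - 1)) := by
    intro F
    rw [hE, Finset.sum_image hinj]
    conv_lhs => rw [show s = (s - 2) + 1 + 1 by omega]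
    rw [Finset.sum_range_succ, Finset.sum_range_succ, show s - 2 + 1 = s - 1 by omega]
  have v0 : ∀ i ∈ Finset.range (s - 2), vDist H ⟨0, by omega⟩ (g i) = i := by
    intro i hi
    rw [Finset.mem_range] at hi
    rw [hg _ (by omega), vDist_mk, hd0, hd0]
    simp only
    split_ifs <;> omega
  have v2 : ∀ i ∈ Finset.range (s - 2), vDist H ⟨s - 2, by omega⟩ (g i) = s - 2 - 1 - i := by
    intro i hi
    rw [Finset.mem_range] at hi
    rw [hg _ (by omega), vDist_mk, hd2, hd2]
    simp only
    split_ifs <;> omega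
  unfold DD
  rw [hsum, hsum, Finset.sum_congr rfl v0, Finset.sum_congr rfl v2,
    Finset.sum_range_reflect (fun i => i) (s - 2), hg', hg (s - 2) (by omega)]
  simp only [vDist_mk, hd0, hd2]
  split_ifs <;> omega


set_option maxHeartbeats 1000000 in
theorem stmt11 {V1 V2 : Type*} [Fintype V1] [Fintype V2]
    (G1 : SimpleGraph V1) (G2 : SimpleGraph V2)
    (h1 : G1.Connected) (h2 : G2.Connected)
    (hn1 : 2 ≤ Fintype.card V1) (hn2 : 2 ≤ Fintype.card V2)
    (u : V1) (v : V2) (m1 m2 : ℕ)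
    (hm1 : m1 = G1.edgeFinset.card) (hm2 : m2 = G2.edgeFinset.card)
    (hm1' : 1 ≤ m1) (hm12 : m1 ≤ m2)
    (s : ℕ) (hs : 4 ≤ s)
    (H H' : SimpleGraph (Fin s))
    (hH : H = SimpleGraph.fromRel (fun a b =>
        (SimpleGraph.pathGraph s).Adj a b ∨
        (a = (⟨s - 3, by omega⟩ : Fin s) ∧ b = (⟨s - 1, by omega⟩ : Fin s))))
    (hH' : H' = SimpleGraph.fromRel (fun a b =>
        ((SimpleGraph.pathGraph s).Adj a b ∧
          s(a, b) ≠ s((⟨s - 2, by omega⟩ : Fin s), (⟨s - 1, by omega⟩ : Fin s))) ∨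
        (a = (⟨0, by omega⟩ : Fin s) ∧ b = (⟨s - 1, by omega⟩ : Fin s)) ∨
        (a = (⟨1, by omega⟩ : Fin s) ∧ b = (⟨s - 1, by omega⟩ : Fin s))))
    (G : SimpleGraph ((Fin s ⊕ {y : V1 // y ≠ u}) ⊕ {y : V2 // y ≠ v}))
    (hG : G = joinAt (joinAt H G1 (⟨0, by omega⟩ : Fin s) u) G2
        (Sum.inl (⟨s - 2, by omega⟩ : Fin s)) v)
    (G' : SimpleGraph ((Fin s ⊕ {y : V1 // y ≠ u}) ⊕ {y : V2 // y ≠ v}))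
    (hG' : G' = joinAt (joinAt H' G1 (⟨0, by omega⟩ : Fin s) u) G2
        (Sum.inl (⟨s - 2, by omega⟩ : Fin s)) v) :
    (edgeWiener G' : ℤ) - (edgeWiener G : ℤ) = ((m2 : ℤ) - m1) * (2 * s - 6) ∧
      edgeWiener G ≤ edgeWiener G' ∧
      (edgeWiener G = edgeWiener G' ↔ m1 = m2) := by
  have hHc : H.Connected ∧ DD H ⟨0, by omega⟩ = DD H ⟨s - 2, by omega⟩ + (2 * s - 6) := by
    refine H_facts s hs H ?_
    intro a b
    rw [hH, fromRel_adj, pathGraph_adj, pathGraph_adj]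
    simp only [Fin.ext_iff, ne_eq]
    have := a.2
    have := b.2
    omega
  have hiso : ∀ x y, H'.Adj (flipE s (by omega) x) (flipE s (by omega) y) ↔ H.Adj x y := by
    intro x y
    rw [hH, hH', fromRel_adj, fromRel_adj, pathGraph_adj, pathGraph_adj, pathGraph_adj,
      pathGraph_adj]
    simp only [Fin.ext_iff, ne_eq, Sym2.eq_iff, flipE_val]
    have := x.2
    have := y.2
    split_ifs <;> omega
  obtain ⟨hHc, hDD⟩ := hHc
  have hHc' := iso_conn _ _ _ hiso hHc
  have e0 : flipE s (by omega) ⟨0, by omega⟩ = ⟨s - 2, by omega⟩ := by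
    apply Fin.ext
    rw [flipE_val]
    split_ifs with h <;> simp at h ⊢; omega
  have e2 : flipE s (by omega) ⟨s - 2, by omega⟩ = ⟨0, by omega⟩ := by
    apply Fin.ext
    rw [flipE_val]
    split_ifs with h <;> simp at h ⊢; omega
  have hS := iso_SS _ _ _ hiso hHc
  have hM := iso_MM _ _ _ hiso
  have hD0 := iso_DD _ _ _ hiso hHc ⟨0, by omega⟩
  have hD2 := iso_DD _ _ _ hiso hHc ⟨s - 2, by omega⟩
  have hdd := iso_dist _ _ _ hiso hHc hHc' ⟨0, by omega⟩ ⟨s - 2, by omega⟩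
  rw [e0] at hD0 hdd
  rw [e2] at hD2 hdd
  rw [H.dist_comm] at hdd
  have hm1 : MM G1 = m1 := hm1.symm
  have hm2 : MM G2 = m2 := hm2.symm
  have key : SS G' + 2 * (m1 * (2 * s - 6)) = SS G + 2 * (m2 * (2 * s - 6)) := by
    rw [hG, hG', join_SS _ _ _ _ (joinAt_conn _ _ _ _ hHc h1) h2,
      join_SS _ _ _ _ (joinAt_conn _ _ _ _ hHc' h1) h2,
      join_SS _ _ _ _ hHc h1, join_SS _ _ _ _ hHc' h1, join_DD _ _ _ _ hHc h1,
      join_DD _ _ _ _ hHc' h1, join_MM, join_MM, hS, hM, hD0, hD2, hdd, hDD, hm1, hm2]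
    ring
  have eG : edgeWiener G = SS G / 2 := rfl
  have eG' : edgeWiener G' = SS G' / 2 := rfl
  have key2 : edgeWiener G' + m1 * (2 * s - 6) = edgeWiener G + m2 * (2 * s - 6) := by
    rw [eG, eG']
    omega
  obtain ⟨t, ht⟩ : ∃ t, 2 * s - 6 = t + 1 := ⟨2 * s - 7, by omega⟩
  have hle : m1 * (2 * s - 6) ≤ m2 * (2 * s - 6) := Nat.mul_le_mul_right _ hm12
  refine ⟨?_, by omega, ?_⟩
  · have hc : ((2 * s - 6 : ℕ) : ℤ) = 2 * s - 6 := by omega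
    rw [← hc]
    have : ((edgeWiener G' + m1 * (2 * s - 6) : ℕ) : ℤ) =
      ((edgeWiener G + m2 * (2 * s - 6) : ℕ) : ℤ) := by rw [key2]
    simp only [Nat.cast_add, Nat.cast_mul] at this
    linarith
  · constructor
    · intro h
      have : m1 * (2 * s - 6) = m2 * (2 * s - 6) := by omega
      exact Nat.eq_of_mul_eq_mul_right (by omega) this
    · rintro rfl
      omega
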